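/- In the constrained composition setup, with δ = δ(w, z) and K_H = (1 + K_max · d_max)^H, the Hellinger distance between the induced densities satisfies h(p_{C_w}, p_{C_z}) ≤ K_H · δ · e^{K_H δ / 2}. -/

import Mathlib

open Set MeasureTheory

/-- The cube `[-1,1]^n` in `ℝ^n`. -/
def cube (n : ℕ) : Set (Fin n → ℝ) := Set.univ.pi fun _ => Set.Icc (-1 : ℝ) 1

/-- Iterated composition of the layer maps: `iterComp d w k = w_k ∘ ⋯ ∘ w_1` in the paper's
1-indexed notation (0-indexed layers `h = 0, …, H-1` here). -/
def iterComp (d : ℕ → ℕ) (w : ∀ h : ℕ, (Fin (d h) → ℝ) → (Fin (d (h + 1)) → ℝ)) :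
    ∀ k : ℕ, (Fin (d 0) → ℝ) → (Fin (d k) → ℝ)
  | 0 => fun t => t
  | k + 1 => fun t => w k (iterComp d w k t)

/-- The density `p_F(t) = e^{F(t)} / ∫_{[-1,1]^n} e^{F(s)} ds` induced by `F` on `[-1,1]^n`. -/
noncomputable def pdens (n : ℕ) (F : (Fin n → ℝ) → ℝ) (t : Fin n → ℝ) : ℝ :=
  Real.exp (F t) / ∫ s in cube n, Real.exp (F s)

/-- The Hellinger distance between two densities on `[-1,1]^n`. -/
noncomputable def hellinger (n : ℕ) (p q : (Fin n → ℝ) → ℝ) : ℝ :=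
  Real.sqrt (∫ t in cube n, (Real.sqrt (p t) - Real.sqrt (q t)) ^ 2)

theorem isCompact_cube (n : ℕ) : IsCompact (cube n) :=
  isCompact_univ_pi fun _ => isCompact_Icc

theorem convex_cube (n : ℕ) : Convex ℝ (cube n) :=
  convex_pi fun _ _ => convex_Icc _ _

theorem zero_mem_cube (n : ℕ) : (0 : Fin n → ℝ) ∈ cube n := fun _ _ => by
  simp

theorem mem_cube_of_abs_le {n : ℕ} {t : Fin n → ℝ} (h : ∀ i, |t i| ≤ 1) : t ∈ cube n :=
  fun i _ => abs_le.1 (h i)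

theorem measurableSet_cube (n : ℕ) : MeasurableSet (cube n) :=
  (isCompact_cube n).isClosed.measurableSet

theorem volume_cube_pos (n : ℕ) : 0 < volume (cube n) := by
  rw [cube, volume_pi_pi, pos_iff_ne_zero, Finset.prod_ne_zero_iff]
  intro _ _
  norm_num [Real.volume_Icc]

theorem ContinuousOn.integrableOn_exp_cube {n : ℕ} {F : (Fin n → ℝ) → ℝ}
    (hF : ContinuousOn F (cube n)) : IntegrableOn (fun s => Real.exp (F s)) (cube n) :=
  hF.rexp.integrableOn_compact (isCompact_cube n)

theorem setIntegral_exp_cube_pos {n : ℕ} {F : (Fin n → ℝ) → ℝ}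
    (hF : ContinuousOn F (cube n)) : 0 < ∫ s in cube n, Real.exp (F s) := by
  refine (setIntegral_pos_iff_support_of_nonneg_ae
    (Filter.Eventually.of_forall fun _ => (Real.exp_pos _).le) hF.integrableOn_exp_cube).2 ?_
  have : Function.support (fun s => Real.exp (F s)) = univ := by
    ext s; simp [Real.exp_ne_zero]
  rw [this, univ_inter]
  exact volume_cube_pos n

theorem pdens_nonneg (n : ℕ) (F : (Fin n → ℝ) → ℝ) (t : Fin n → ℝ) : 0 ≤ pdens n F t :=
  div_nonneg (Real.exp_pos _).le (integral_nonneg fun _ => (Real.exp_pos _).le)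

theorem integrableOn_pdens {n : ℕ} {F : (Fin n → ℝ) → ℝ} (hF : ContinuousOn F (cube n)) :
    IntegrableOn (pdens n F) (cube n) :=
  hF.integrableOn_exp_cube.div_const _

theorem setIntegral_pdens {n : ℕ} {F : (Fin n → ℝ) → ℝ} (hF : ContinuousOn F (cube n)) :
    ∫ t in cube n, pdens n F t = 1 := by
  simp only [pdens, integral_div]
  exact div_self (setIntegral_exp_cube_pos hF).ne'

theorem pdens_le_exp_mul_pdens {n : ℕ} {F G : (Fin n → ℝ) → ℝ} {ε : ℝ}
    (hF : ContinuousOn F (cube n)) (hG : ContinuousOn G (cube n))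
    (h : ∀ t ∈ cube n, |F t - G t| ≤ ε) {t : Fin n → ℝ} (ht : t ∈ cube n) :
    pdens n F t ≤ Real.exp ε ^ 2 * pdens n G t := by
  have hA := setIntegral_exp_cube_pos hF
  have hB := setIntegral_exp_cube_pos hG
  have hnum : Real.exp (F t) ≤ Real.exp ε * Real.exp (G t) := by
    rw [← Real.exp_add, Real.exp_le_exp]
    linarith [(abs_le.1 (h t ht)).2]
  have hden : ∫ s in cube n, Real.exp (G s) ≤ Real.exp ε * ∫ s in cube n, Real.exp (F s) := by
    rw [← integral_const_mul]
    refine setIntegral_mono_on hG.integrableOn_exp_cube (hF.integrableOn_exp_cube.const_mul _)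
      (measurableSet_cube n) fun s hs => ?_
    rw [← Real.exp_add, Real.exp_le_exp]
    linarith [(abs_le.1 (h s hs)).1]
  rw [pdens, pdens, ← mul_div_assoc, div_le_div_iff₀ hA hB]
  calc _ ≤ (Real.exp ε * Real.exp (G t)) * (Real.exp ε * ∫ s in cube n, Real.exp (F s)) := by
        gcongr
    _ = _ := by ring

theorem sq_sub_le_of_le_exp_mul {x y ε : ℝ} (hx : 0 ≤ x) (hy : 0 ≤ y) (hε : 0 ≤ ε)
    (hxy : x ≤ Real.exp ε * y) (hyx : y ≤ Real.exp ε * x) :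
    (x - y) ^ 2 ≤ (ε * Real.exp (ε / 2)) ^ 2 * ((x ^ 2 + y ^ 2) / 2) := by
  have hsq : Real.exp ε = Real.exp (ε / 2) ^ 2 := by
    rw [← Real.exp_nat_mul]; congr 1; push_cast; ring
  have hinv : Real.exp ε * Real.exp (-ε) = 1 := by rw [← Real.exp_add]; simp
  have hdiff : (Real.exp ε - 1) ^ 2 ≤ ε ^ 2 * Real.exp ε ^ 2 := by
    rw [← mul_pow]
    have h1 : 1 ≤ Real.exp ε := Real.one_le_exp hε
    have h2 : 1 - ε ≤ Real.exp (-ε) := by linarith [Real.add_one_le_exp (-ε)]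
    exact pow_le_pow_left₀ (by linarith) (by nlinarith [Real.exp_pos ε]) 2
  have hprod : Real.exp ε * (x - y) ^ 2 ≤ (Real.exp ε - 1) ^ 2 * (x * y) := by
    nlinarith [mul_nonneg (sub_nonneg.2 hxy) (sub_nonneg.2 hyx)]
  have hamgm : x * y ≤ (x ^ 2 + y ^ 2) / 2 := by nlinarith [sq_nonneg (x - y)]
  have key : Real.exp ε * (x - y) ^ 2 ≤
      Real.exp ε * ((ε ^ 2 * Real.exp ε) * ((x ^ 2 + y ^ 2) / 2)) :=
    calc _ ≤ (Real.exp ε - 1) ^ 2 * (x * y) := hprod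
      _ ≤ (ε ^ 2 * Real.exp ε ^ 2) * ((x ^ 2 + y ^ 2) / 2) := by gcongr
      _ = _ := by ring
  rw [mul_pow, ← hsq]
  exact le_of_mul_le_mul_left key (Real.exp_pos ε)

theorem hellinger_pdens_le {n : ℕ} {F G : (Fin n → ℝ) → ℝ} {ε : ℝ}
    (hF : ContinuousOn F (cube n)) (hG : ContinuousOn G (cube n))
    (h : ∀ t ∈ cube n, |F t - G t| ≤ ε) :
    hellinger n (pdens n F) (pdens n G) ≤ ε * Real.exp (ε / 2) := by
  have hε : 0 ≤ ε := (abs_nonneg _).trans (h 0 (zero_mem_cube n))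
  have h' : ∀ t ∈ cube n, |G t - F t| ≤ ε := fun t ht => by rw [abs_sub_comm]; exact h t ht
  have hsqrt : ∀ {a b : ℝ}, a ≤ Real.exp ε ^ 2 * b → √a ≤ Real.exp ε * √b := fun {a b} hab => by
    refine (Real.sqrt_le_sqrt hab).trans_eq ?_
    rw [Real.sqrt_mul (sq_nonneg _), Real.sqrt_sq (Real.exp_pos ε).le]
  have hint : IntegrableOn (fun t => (ε * Real.exp (ε / 2)) ^ 2 *
      ((pdens n F t + pdens n G t) / 2)) (cube n) :=
    (((integrableOn_pdens hF).add (integrableOn_pdens hG)).div_const 2).const_mul _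
  refine Real.sqrt_le_iff.2 ⟨by positivity, ?_⟩
  calc ∫ t in cube n, (√(pdens n F t) - √(pdens n G t)) ^ 2
      ≤ ∫ t in cube n, (ε * Real.exp (ε / 2)) ^ 2 * ((pdens n F t + pdens n G t) / 2) := by
        refine integral_mono_of_nonneg (Filter.Eventually.of_forall fun _ => sq_nonneg _) hint
          ((ae_restrict_iff' (measurableSet_cube n)).2 (Filter.Eventually.of_forall fun t ht => ?_))
        have := sq_sub_le_of_le_exp_mul (Real.sqrt_nonneg _) (Real.sqrt_nonneg _) hε
          (hsqrt (pdens_le_exp_mul_pdens hF hG h ht)) (hsqrt (pdens_le_exp_mul_pdens hG hF h' ht))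
        rwa [Real.sq_sqrt (pdens_nonneg n F t), Real.sq_sqrt (pdens_nonneg n G t)] at this
    _ = (ε * Real.exp (ε / 2)) ^ 2 := by
        rw [integral_const_mul, integral_div,
          integral_add (integrableOn_pdens hF) (integrableOn_pdens hG),
          setIntegral_pdens hF, setIntegral_pdens hG]
        ring

theorem norm_le_of_abs_apply_single_le {n : ℕ} {K : ℝ} (hK : 0 ≤ K) (L : (Fin n → ℝ) →L[ℝ] ℝ)
    (hL : ∀ j, |L (Pi.single j 1)| ≤ K) : ‖L‖ ≤ K * n := by
  refine L.opNorm_le_bound (by positivity) fun v => ?_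
  have hv : L v = ∑ j, v j * L (Pi.single j 1) := by
    conv_lhs => rw [pi_eq_sum_univ' v, map_sum]
    simp
  rw [hv]
  calc ‖∑ j, v j * L (Pi.single j 1)‖ ≤ ∑ j, ‖v j * L (Pi.single j 1)‖ := norm_sum_le _ _
    _ ≤ ∑ _j : Fin n, ‖v‖ * K := by
        refine Finset.sum_le_sum fun j _ => ?_
        rw [norm_mul]
        exact mul_le_mul (norm_le_pi_norm v j) (hL j) (norm_nonneg _) (norm_nonneg _)
    _ = K * n * ‖v‖ := by simp; ring

theorem abs_sub_le_of_abs_partial_le {n : ℕ} {K : ℝ} (hK : 0 ≤ K) {f : (Fin n → ℝ) → ℝ}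
    (hf : DifferentiableOn ℝ f (cube n))
    (hf' : ∀ j, ∀ t ∈ cube n, |fderivWithin ℝ f (cube n) t (Pi.single j 1)| ≤ K)
    {x y : Fin n → ℝ} (hx : x ∈ cube n) (hy : y ∈ cube n) :
    |f x - f y| ≤ K * n * ‖x - y‖ :=
  (convex_cube n).norm_image_sub_le_of_norm_fderivWithin_le hf
    (fun t ht => norm_le_of_abs_apply_single_le hK _ fun j => hf' j t ht) hy hx

section Composition

variable {H : ℕ} {d : ℕ → ℕ} {w z : ∀ h : ℕ, (Fin (d h) → ℝ) → (Fin (d (h + 1)) → ℝ)}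

theorem iterComp_mem_cube (hwval : ∀ h, h + 1 < H → ∀ i, ∀ t ∈ cube (d h), |w h t i| ≤ 1)
    {t : Fin (d 0) → ℝ} (ht : t ∈ cube (d 0)) : ∀ {k}, k < H → iterComp d w k t ∈ cube (d k)
  | 0, _ => ht
  | k + 1, hk => mem_cube_of_abs_le fun i =>
      hwval k hk i _ (iterComp_mem_cube hwval ht (Nat.lt_of_succ_lt hk))

theorem continuousOn_iterComp
    (hwcont : ∀ h, h < H → ∀ i, ContinuousOn (fun t => w h t i) (cube (d h)))
    (hwval : ∀ h, h + 1 < H → ∀ i, ∀ t ∈ cube (d h), |w h t i| ≤ 1) :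
    ∀ {k}, k ≤ H → ContinuousOn (iterComp d w k) (cube (d 0))
  | 0, _ => continuousOn_id
  | k + 1, hk => (continuousOn_pi.2 (hwcont k hk)).comp
      (continuousOn_iterComp hwcont hwval (Nat.le_of_succ_le hk))
      fun _ ht => iterComp_mem_cube hwval ht hk

theorem norm_iterComp_sub_le {K c δ : ℝ} (hK : 0 ≤ K) (hδ0 : 0 ≤ δ)
    (hc : ∀ h, h < H → K * d h ≤ c)
    (hwval : ∀ h, h + 1 < H → ∀ i, ∀ t ∈ cube (d h), |w h t i| ≤ 1)
    (hzval : ∀ h, h + 1 < H → ∀ i, ∀ t ∈ cube (d h), |z h t i| ≤ 1)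
    (hwdiff : ∀ h, 1 ≤ h → h < H → ∀ i, DifferentiableOn ℝ (fun t => w h t i) (cube (d h)))
    (hwderiv : ∀ h, 1 ≤ h → h < H → ∀ i j, ∀ t ∈ cube (d h),
      |fderivWithin ℝ (fun s => w h s i) (cube (d h)) t (Pi.single j 1)| ≤ K)
    (hδ : ∀ h, h < H → ∀ i, ∀ t ∈ cube (d h), |w h t i - z h t i| ≤ δ)
    {t : Fin (d 0) → ℝ} (ht : t ∈ cube (d 0)) {k : ℕ} (hk : k ≤ H) :
    ‖iterComp d w k t - iterComp d z k t‖ ≤ (1 + c) ^ k * δ := by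
  induction k with
  | zero => simpa [iterComp] using hδ0
  | succ k ih =>
    have hc0 : 0 ≤ c := le_trans (by positivity) (hc k hk)
    have hx := iterComp_mem_cube hwval ht hk
    have hy := iterComp_mem_cube hzval ht hk
    refine (pi_norm_le_iff_of_nonneg (by positivity)).2 fun i => ?_
    have hlip : |w k (iterComp d w k t) i - w k (iterComp d z k t) i| ≤ c * ((1 + c) ^ k * δ) := by
      rcases Nat.eq_zero_or_pos k with rfl | hk0
      · simp only [iterComp, sub_self, abs_zero]; positivity
      · exact (abs_sub_le_of_abs_partial_le hK (hwdiff k hk0 hk i) (hwderiv k hk0 hk i) hx hy).trans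
          (mul_le_mul (hc k hk) (ih (Nat.le_of_succ_le hk)) (norm_nonneg _) hc0)
    have hone : δ ≤ (1 + c) ^ k * δ :=
      le_mul_of_one_le_left hδ0 (one_le_pow₀ (by linarith))
    calc ‖(iterComp d w (k + 1) t - iterComp d z (k + 1) t) i‖
        ≤ |w k (iterComp d w k t) i - w k (iterComp d z k t) i|
          + |w k (iterComp d z k t) i - z k (iterComp d z k t) i| := abs_sub_le _ _ _
      _ ≤ c * ((1 + c) ^ k * δ) + (1 + c) ^ k * δ :=
          add_le_add hlip ((hδ k hk i _ hy).trans hone)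
      _ = (1 + c) ^ (k + 1) * δ := by ring

end Composition

/-- in the constrained composition setup, the Hellinger distance between the
induced densities satisfies `h(p_{C_w}, p_{C_z}) ≤ K_H δ e^{K_H δ / 2}`
with `K_H = (1 + K_max d_max)^H`. -/
theorem stmt5
    (H : ℕ) (hH : 2 ≤ H)
    (d : ℕ → ℕ) (hd : ∀ h, h ≤ H → 0 < d h) (hdH : d H = 1)
    (dmax : ℕ) (hdmax : ∀ h, h < H → d h ≤ dmax)
    (Kmax : ℝ) (hKmax : 0 < Kmax)
    (w z : ∀ h : ℕ, (Fin (d h) → ℝ) → (Fin (d (h + 1)) → ℝ))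
    (hwcont : ∀ h, h < H → ∀ i, ContinuousOn (fun t => w h t i) (cube (d h)))
    (hzcont : ∀ h, h < H → ∀ i, ContinuousOn (fun t => z h t i) (cube (d h)))
    (hwval : ∀ h, h + 1 < H → ∀ i, ∀ t ∈ cube (d h), |w h t i| ≤ 1)
    (hzval : ∀ h, h + 1 < H → ∀ i, ∀ t ∈ cube (d h), |z h t i| ≤ 1)
    (hwsmooth : ∀ h, 1 ≤ h → h < H → ∀ i, ContDiffOn ℝ 1 (fun t => w h t i) (cube (d h)))
    (hzsmooth : ∀ h, 1 ≤ h → h < H → ∀ i, ContDiffOn ℝ 1 (fun t => z h t i) (cube (d h)))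
    (hwderiv : ∀ h, 1 ≤ h → h < H → ∀ i j, ∀ t ∈ cube (d h),
      |fderivWithin ℝ (fun s => w h s i) (cube (d h)) t (Pi.single j 1)| ≤ Kmax)
    (hzderiv : ∀ h, 1 ≤ h → h < H → ∀ i j, ∀ t ∈ cube (d h),
      |fderivWithin ℝ (fun s => z h s i) (cube (d h)) t (Pi.single j 1)| ≤ Kmax)
    (δ : ℝ) (hδ : ∀ h, h < H → ∀ i, ∀ t ∈ cube (d h), |w h t i - z h t i| ≤ δ) :
    ∀ i : Fin (d H),
      hellinger (d 0) (pdens (d 0) fun t => iterComp d w H t i)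
          (pdens (d 0) fun t => iterComp d z H t i)
        ≤ (1 + Kmax * dmax) ^ H * δ * Real.exp ((1 + Kmax * dmax) ^ H * δ / 2) := by
  intro i
  have hδ0 : 0 ≤ δ := (abs_nonneg _).trans
    (hδ 0 (by omega) ⟨0, hd 1 (by omega)⟩ 0 (zero_mem_cube _))
  have hbound : ∀ t ∈ cube (d 0),
      |iterComp d w H t i - iterComp d z H t i| ≤ (1 + Kmax * dmax) ^ H * δ := fun t ht =>
    (norm_le_pi_norm (iterComp d w H t - iterComp d z H t) i).trans <|
      norm_iterComp_sub_le hKmax.le hδ0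
        (fun h hh => mul_le_mul_of_nonneg_left (Nat.cast_le.2 (hdmax h hh)) hKmax.le)
        hwval hzval (fun h h1 hh i => (hwsmooth h h1 hh i).differentiableOn one_ne_zero)
        hwderiv hδ ht le_rfl
  exact hellinger_pdens_le
    (continuousOn_pi.1 (continuousOn_iterComp hwcont hwval le_rfl) i)
    (continuousOn_pi.1 (continuousOn_iterComp hzcont hzval le_rfl) i) hbound
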